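/- arXiv:2209.00434 — 7 statements merged into one kernel-verified Lean document; each statement's English description precedes it below -/
import Mathlib

section
/- For every real number t, the truncated singular integrals (1/π) ∫_{ε ≤ |t-τ| ≤ 1/ε} sin(τ)/(t-τ) dτ converge, as ε → 0⁺, to -cos(t). (That is, the Hilbert transform of the sine signal, defined as a Cauchy principal value, equals minus the cosine signal.) -/
open MeasureTheory Set Filter Topology

lemma inner_x (R y : ℝ) : ∫ x in (0:ℝ)..R, Real.sin x * Real.exp (-x * y) =
    (1 + y ^ 2)⁻¹ - Real.exp (-R * y) * ((y * Real.sin R + Real.cos R) / (1 + y ^ 2)) := by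
  have hy : (1 + y ^ 2) ≠ 0 := by positivity
  have hd : ∀ x ∈ uIcc (0:ℝ) R, HasDerivAt
      (fun x : ℝ => -(Real.exp (-x * y) * ((y * Real.sin x + Real.cos x) / (1 + y ^ 2))))
      (Real.sin x * Real.exp (-x * y)) x := by
    intro x _
    have h1 : HasDerivAt (fun x : ℝ => Real.exp (-x * y)) (Real.exp (-x * y) * (-1 * y)) x :=
      (((hasDerivAt_id x).neg).mul_const y).exp
    have h2 : HasDerivAt (fun x : ℝ => (y * Real.sin x + Real.cos x) / (1 + y ^ 2))
        ((y * Real.cos x + -Real.sin x) / (1 + y ^ 2)) x :=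
      (((Real.hasDerivAt_sin x).const_mul y).add (Real.hasDerivAt_cos x)).div_const _
    refine HasDerivAt.congr_deriv (h1.mul h2).neg ?_
    field_simp
    ring
  rw [intervalIntegral.integral_eq_sub_of_hasDerivAt hd
    (Continuous.intervalIntegrable (by fun_prop) _ _)]
  simp
  ring

lemma inner_y (x : ℝ) (hx : 0 < x) :
    ∫ y in Ioi (0:ℝ), Real.sin x * Real.exp (-x * y) = Real.sinc x := by
  rw [integral_const_mul, integral_exp_mul_Ioi (by linarith), Real.sinc_of_ne_zero hx.ne']
  simp [div_eq_mul_inv]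

lemma prod_int (R : ℝ) : Integrable
    (Function.uncurry fun x y : ℝ => Real.sin x * Real.exp (-x * y))
    ((volume.restrict (Ioc 0 R)).prod (volume.restrict (Ioi 0))) := by
  have hm : AEStronglyMeasurable (Function.uncurry fun x y : ℝ => Real.sin x * Real.exp (-x * y))
    ((volume.restrict (Ioc 0 R)).prod (volume.restrict (Ioi 0))) := by
    apply Continuous.aestronglyMeasurable
    unfold Function.uncurry
    fun_prop
  rw [integrable_prod_iff hm]
  constructor
  · filter_upwards [ae_restrict_mem measurableSet_Ioc] with x hx
    exact (integrableOn_exp_mul_Ioi (a := -x) (by linarith [hx.1]) 0).const_mul (Real.sin x)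
  · have : IntegrableOn (fun x => |Real.sinc x|) (Ioc 0 R) :=
      (Real.continuous_sinc.abs.integrableOn_Icc).mono_set Ioc_subset_Icc_self
    refine Integrable.congr this ?_
    filter_upwards [ae_restrict_mem measurableSet_Ioc] with x hx
    have hx0 := hx.1
    simp only [Function.uncurry, norm_mul, Real.norm_eq_abs, Real.abs_exp]
    rw [integral_const_mul, integral_exp_mul_Ioi (by linarith), Real.sinc_of_ne_zero hx0.ne',
      abs_div, abs_of_pos hx0]
    simp [div_eq_mul_inv]

lemma sinc_bound (R : ℝ) (hR : 0 < R) :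
    |(∫ x in (0:ℝ)..R, Real.sinc x) - Real.pi / 2| ≤ 2 / R := by
  have e1 : ∫ x in (0:ℝ)..R, Real.sinc x = ∫ y in Ioi (0:ℝ), ((1 + y ^ 2)⁻¹ -
      Real.exp (-R * y) * ((y * Real.sin R + Real.cos R) / (1 + y ^ 2))) := by
    rw [intervalIntegral.integral_of_le hR.le]
    rw [← setIntegral_congr_fun measurableSet_Ioc (fun x hx => inner_y x hx.1)]
    rw [integral_integral_swap (prod_int R)]
    refine integral_congr_ae (Eventually.of_forall fun y => ?_)
    simp only
    rw [← inner_x, intervalIntegral.integral_of_le hR.le]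
  have hE : IntegrableOn (fun y : ℝ => Real.exp (-R * y)) (Ioi 0) :=
    integrableOn_exp_mul_Ioi (by linarith) 0
  have hb : ∀ y ∈ Ioi (0:ℝ), ‖Real.exp (-R * y) * ((y * Real.sin R + Real.cos R) / (1 + y ^ 2))‖
      ≤ Real.exp (-R * y) * 2 := by
    intro y hy
    have hy : 0 < y := hy
    rw [norm_mul, Real.norm_eq_abs, Real.abs_exp]
    gcongr
    rw [Real.norm_eq_abs, abs_div, abs_of_pos (by positivity : 0 < 1 + y ^ 2),
      div_le_iff₀ (by positivity)]
    have : |y * Real.sin R + Real.cos R| ≤ y * 1 + 1 := by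
      refine (abs_add_le _ _).trans ?_
      rw [abs_mul, abs_of_pos hy]
      gcongr
      · exact Real.abs_sin_le_one R
      · exact Real.abs_cos_le_one R
    nlinarith [sq_nonneg (y - 1)]
  have hb' : ∀ᵐ y ∂(volume.restrict (Ioi (0:ℝ))),
      ‖Real.exp (-R * y) * ((y * Real.sin R + Real.cos R) / (1 + y ^ 2))‖
      ≤ Real.exp (-R * y) * 2 := by
    filter_upwards [ae_restrict_mem measurableSet_Ioi] with y hy using hb y hy
  have hI : Integrable (fun y : ℝ => Real.exp (-R * y) *
      ((y * Real.sin R + Real.cos R) / (1 + y ^ 2))) (volume.restrict (Ioi (0:ℝ))) := by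
    refine Integrable.mono' (hE.mul_const 2) ?_ hb'
    apply Continuous.aestronglyMeasurable
    have : ∀ y : ℝ, 1 + y ^ 2 ≠ 0 := fun y => by positivity
    fun_prop (disch := assumption)
  rw [e1, integral_sub integrable_inv_one_add_sq.integrableOn hI, integral_Ioi_inv_one_add_sq]
  simp only [Real.arctan_zero, sub_zero, sub_sub_cancel_left, abs_neg]
  rw [← Real.norm_eq_abs]
  refine (norm_integral_le_of_norm_le (hE.mul_const 2) hb').trans (le_of_eq ?_)
  rw [integral_mul_const, integral_exp_mul_Ioi (by linarith)]
  simp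
  ring

lemma dirichlet : Tendsto (fun R : ℝ => ∫ x in (0:ℝ)..R, Real.sinc x) atTop (𝓝 (Real.pi / 2)) := by
  rw [tendsto_iff_norm_sub_tendsto_zero]
  refine squeeze_zero' (Eventually.of_forall fun _ => norm_nonneg _) ?_
    (tendsto_const_nhds.div_atTop tendsto_id : Tendsto (fun R : ℝ => 2 / R) atTop (𝓝 0))
  filter_upwards [eventually_gt_atTop 0] with R hR using sinc_bound R hR

lemma trunc (t ε : ℝ) (h0 : 0 < ε) (h1 : ε < 1) :
    ∫ τ in {τ : ℝ | ε ≤ |t - τ| ∧ |t - τ| ≤ 1 / ε}, Real.sin τ / (t - τ) =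
    -2 * Real.cos t * ((∫ x in (0:ℝ)..(1 / ε), Real.sinc x) - ∫ x in (0:ℝ)..ε, Real.sinc x) := by
  have hle : ε ≤ 1 / ε := by
    rw [le_div_iff₀ h0]; nlinarith
  have hS : {τ : ℝ | ε ≤ |t - τ| ∧ |t - τ| ≤ 1 / ε} =
      Icc (t - 1 / ε) (t - ε) ∪ Icc (t + ε) (t + 1 / ε) := by
    ext τ
    simp only [mem_ofPred_eq, mem_union, mem_Icc]
    constructor
    · rintro ⟨ha, hb⟩
      rcases abs_cases (t - τ) with h | h
      · left; constructor <;> linarith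
      · right; constructor <;> linarith
    · rintro (⟨ha, hb⟩ | ⟨ha, hb⟩)
      · rw [abs_of_nonneg (by linarith)]; constructor <;> linarith
      · rw [abs_of_nonpos (by linarith)]; constructor <;> linarith
  have hd : Disjoint (Icc (t - 1 / ε) (t - ε)) (Icc (t + ε) (t + 1 / ε)) := by
    rw [Set.disjoint_left]
    rintro τ ⟨_, h⟩ ⟨h', _⟩
    linarith
  have i1 : IntegrableOn (fun τ => Real.sin τ / (t - τ)) (Icc (t - 1 / ε) (t - ε)) := by
    apply ContinuousOn.integrableOn_Icc
    refine ContinuousOn.div (by fun_prop) (by fun_prop) fun x hx => ?_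
    have := hx.2
    intro h; linarith
  have i2 : IntegrableOn (fun τ => Real.sin τ / (t - τ)) (Icc (t + ε) (t + 1 / ε)) := by
    apply ContinuousOn.integrableOn_Icc
    refine ContinuousOn.div (by fun_prop) (by fun_prop) fun x hx => ?_
    have := hx.1
    intro h; linarith
  rw [hS, setIntegral_union hd measurableSet_Icc i1 i2, integral_Icc_eq_integral_Ioc,
    integral_Icc_eq_integral_Ioc, ← intervalIntegral.integral_of_le (by linarith),
    ← intervalIntegral.integral_of_le (by linarith),
    ← intervalIntegral.integral_comp_sub_left (fun τ => Real.sin τ / (t - τ)) t,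
    ← intervalIntegral.integral_comp_add_left (fun τ => Real.sin τ / (t - τ)) t,
    intervalIntegral.integral_interval_sub_left
      (Real.continuous_sinc.intervalIntegrable _ _) (Real.continuous_sinc.intervalIntegrable _ _),
    ← intervalIntegral.integral_const_mul, ← intervalIntegral.integral_add]
  · apply intervalIntegral.integral_congr
    intro u hu
    rw [uIcc_of_le hle] at hu
    have hu0 : u ≠ 0 := by linarith [hu.1]
    simp only
    rw [Real.sinc_of_ne_zero hu0, Real.sin_sub, Real.sin_add]
    have e1 : t - (t - u) = u := by ring
    have e2 : t - (t + u) = -u := by ring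
    rw [e1, e2]
    field_simp
    ring
  · apply ContinuousOn.intervalIntegrable
    rw [uIcc_of_le hle]
    refine ContinuousOn.div (by fun_prop) (by fun_prop) fun x hx => ?_
    have := hx.1
    intro h; linarith
  · apply ContinuousOn.intervalIntegrable
    rw [uIcc_of_le hle]
    refine ContinuousOn.div (by fun_prop) (by fun_prop) fun x hx => ?_
    have := hx.1
    intro h; linarith

/-- The Hilbert transform of the sine signal, defined as a Cauchy principal value
(limit of truncated singular integrals as ε → 0⁺), equals minus the cosine signal. -/
theorem hilbert_transform_sin (t : ℝ) :
    Filter.Tendsto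
      (fun ε : ℝ => (1 / Real.pi) *
        ∫ τ in {τ : ℝ | ε ≤ |t - τ| ∧ |t - τ| ≤ 1 / ε}, Real.sin τ / (t - τ))
      (nhdsWithin 0 (Set.Ioi 0)) (nhds (-Real.cos t)) := by
  have hA : Tendsto (fun ε : ℝ => ∫ x in (0:ℝ)..(1 / ε), Real.sinc x) (𝓝[>] 0)
      (𝓝 (Real.pi / 2)) := by
    refine dirichlet.comp ?_
    exact (tendsto_inv_nhdsGT_zero (𝕜 := ℝ)).congr fun x => (one_div x).symm
  have hB : Tendsto (fun ε : ℝ => ∫ x in (0:ℝ)..ε, Real.sinc x) (𝓝[>] 0) (𝓝 0) := by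
    have := (intervalIntegral.continuous_primitive
      (fun a b => Real.continuous_sinc.intervalIntegrable (μ := volume) a b) 0).tendsto 0
    rw [intervalIntegral.integral_same] at this
    exact this.mono_left nhdsWithin_le_nhds
  have hC := ((hA.sub hB).const_mul (-2 * Real.cos t)).const_mul (1 / Real.pi)
  have e : 1 / Real.pi * (-2 * Real.cos t * (Real.pi / 2 - 0)) = -Real.cos t := by
    have := Real.pi_ne_zero
    field_simp
    ring
  rw [e] at hC
  refine hC.congr' ?_
  filter_upwards [Ioo_mem_nhdsGT (zero_lt_one (α := ℝ))] with ε hε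
  rw [trunc t ε hε.1 hε.2]
end

section
/- Let N be an even natural number with N ≥ 2, and let n be a natural number with 1 ≤ n < N/2. For the sequence x[k] = cos(ω_n k) (k = 0, …, N-1), the discrete Hilbert transform satisfies (H_d x)[k] = sin(ω_n k) for all k. -/
/-- Discrete Fourier coefficients: `X_n = (1/N) ∑_{k=0}^{N-1} x[k] exp(-2πi n k / N)`. -/
noncomputable def dft (N : ℕ) (x : Fin N → ℂ) (n : Fin N) : ℂ :=
  (1 / (N : ℂ)) * ∑ k : Fin N, x k *
    Complex.exp (-2 * (Real.pi : ℂ) * Complex.I * (n.val : ℂ) * (k.val : ℂ) / (N : ℂ))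

/-- Sign sequence of the discrete Hilbert transform: `S_0 = 0`, `S_n = 1` for
`1 ≤ n ≤ N/2`, and `S_n = -1` for `N/2 + 1 ≤ n ≤ N - 1`. -/
noncomputable def dhtSign (N : ℕ) (n : Fin N) : ℂ :=
  if n.val = 0 then 0 else if n.val ≤ N / 2 then 1 else -1

/-- Discrete Hilbert transform: `(H_d x)[k] = ∑_{n=0}^{N-1} (-i S_n) X_n exp(2πi n k / N)`. -/
noncomputable def dht (N : ℕ) (x : Fin N → ℂ) (k : Fin N) : ℂ :=
  ∑ n : Fin N, (-Complex.I * dhtSign N n) * dft N x n *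
    Complex.exp (2 * (Real.pi : ℂ) * Complex.I * (n.val : ℂ) * (k.val : ℂ) / (N : ℂ))

lemma orth_aux (N : ℕ) (hN : 2 ≤ N) (m : ℤ) :
    ∑ k : Fin N, Complex.exp (2 * (Real.pi : ℂ) * Complex.I * (m : ℂ) * (k.val : ℂ) / (N : ℂ))
      = if (N : ℤ) ∣ m then (N : ℂ) else 0 := by
  have hN0 : N ≠ 0 := by omega
  have hNc : (N : ℂ) ≠ 0 := by exact_mod_cast hN0
  have hp := Complex.isPrimitiveRoot_exp N hN0
  set ζ := Complex.exp (2 * (Real.pi : ℂ) * Complex.I / (N : ℂ)) with hζ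
  have hterm : ∀ k : ℕ, Complex.exp (2 * (Real.pi : ℂ) * Complex.I * (m : ℂ) * (k : ℂ) / (N : ℂ))
      = (ζ ^ m) ^ k := by
    intro k
    rw [hζ, ← Complex.exp_int_mul, ← Complex.exp_nat_mul]
    congr 1
    ring
  simp only [hterm]
  rw [Fin.sum_univ_eq_sum_range (fun k => (ζ ^ m) ^ k) N]
  split_ifs with h
  · rw [(hp.zpow_eq_one_iff_dvd m).2 h]; simp
  · have h1 : ζ ^ m ≠ 1 := fun h' => h ((hp.zpow_eq_one_iff_dvd m).1 h')
    rw [geom_sum_eq h1]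
    have : (ζ ^ m) ^ N = 1 := by
      rw [← zpow_natCast, zpow_comm, zpow_natCast, hp.pow_eq_one, one_zpow]
    simp [this]

lemma dft_cos_aux (N : ℕ) (hN : 2 ≤ N) (n : ℕ) (x : Fin N → ℂ)
    (hx : ∀ k : Fin N, x k = ((Real.cos (2 * Real.pi * n / N * k.val) : ℝ) : ℂ)) (m : Fin N) :
    dft N x m = (if (N : ℤ) ∣ (n : ℤ) - m.val then 1 / 2 else 0)
      + (if (N : ℤ) ∣ -(n : ℤ) - m.val then 1 / 2 else 0) := by
  have hNc : (N : ℂ) ≠ 0 := by exact_mod_cast (by omega : N ≠ 0)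
  have key : ∀ k : Fin N, x k *
      Complex.exp (-2 * (Real.pi : ℂ) * Complex.I * (m.val : ℂ) * (k.val : ℂ) / (N : ℂ))
      = 1 / 2 * Complex.exp (2 * (Real.pi : ℂ) * Complex.I * (((n : ℤ) - m.val : ℤ) : ℂ) * (k.val : ℂ) / (N : ℂ))
      + 1 / 2 * Complex.exp (2 * (Real.pi : ℂ) * Complex.I * ((-(n : ℤ) - m.val : ℤ) : ℂ) * (k.val : ℂ) / (N : ℂ)) := by
    intro k
    rw [hx, Complex.ofReal_cos, Complex.cos, div_mul_eq_mul_div, add_mul, ← Complex.exp_add,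
      ← Complex.exp_add, ← mul_add, one_div, inv_mul_eq_div]
    congr 1
    congr 1 <;> congr 1 <;> push_cast <;> ring
  unfold dft
  simp only [key]
  rw [Finset.sum_add_distrib, ← Finset.mul_sum, ← Finset.mul_sum, orth_aux N hN, orth_aux N hN]
  split_ifs <;> field_simp <;> simp

/-- For the sequence `x[k] = cos(ω_n k)` with `ω_n = 2πn/N`, `1 ≤ n < N/2`, the
discrete Hilbert transform satisfies `(H_d x)[k] = sin(ω_n k)` for all `k`. -/
theorem dht_cos (N : ℕ) (hNeven : Even N) (hN : 2 ≤ N) (n : ℕ) (hn1 : 1 ≤ n)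
    (hn2 : n < N / 2) (x : Fin N → ℂ)
    (hx : ∀ k : Fin N, x k = ((Real.cos (2 * Real.pi * n / N * k.val) : ℝ) : ℂ)) :
    ∀ k : Fin N, dht N x k = ((Real.sin (2 * Real.pi * n / N * k.val) : ℝ) : ℂ) := by
  intro k
  have hNc : (N : ℂ) ≠ 0 := by exact_mod_cast (by omega : N ≠ 0)
  have h1 : ∀ m : Fin N, ((N : ℤ) ∣ (n : ℤ) - m.val) ↔ m = ⟨n, by omega⟩ := by
    intro m
    have := m.2
    rw [Fin.ext_iff]
    constructor
    · rintro h
      have := Int.eq_zero_of_abs_lt_dvd h (by rw [abs_lt]; omega)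
      simp only; omega
    · intro h
      simp only at h
      simp [h]
  have h2 : ∀ m : Fin N, ((N : ℤ) ∣ -(n : ℤ) - m.val) ↔ m = ⟨N - n, by omega⟩ := by
    intro m
    have := m.2
    rw [Fin.ext_iff]
    constructor
    · rintro h
      have h' : (N : ℤ) ∣ (N : ℤ) - n - m.val := by
        have := dvd_add (dvd_refl (N : ℤ)) h
        have e : (N : ℤ) - n - m.val = N + (-(n : ℤ) - m.val) := by ring
        rw [e]
        exact this
      have := Int.eq_zero_of_abs_lt_dvd h' (by rw [abs_lt]; omega)
      simp only; omega
    · intro h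
      simp only at h
      exact ⟨-1, by omega⟩
  unfold dht
  simp only [dft_cos_aux N hN n x hx, h1, h2, mul_add, add_mul, Finset.sum_add_distrib,
    mul_ite, ite_mul, mul_zero, zero_mul, Finset.sum_ite_eq', Finset.sum_ite_eq,
    Finset.mem_univ, if_true]
  have s1 : dhtSign N ⟨n, by omega⟩ = 1 := by
    unfold dhtSign
    rw [if_neg (by simp only; omega), if_pos (by simp only; omega)]
  have s2 : dhtSign N ⟨N - n, by omega⟩ = -1 := by
    unfold dhtSign
    rw [if_neg (by simp only; omega), if_neg (by simp only; omega)]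
  have e2 : Complex.exp (2 * (Real.pi : ℂ) * Complex.I * ((N - n : ℕ) : ℂ) * (k.val : ℂ) / (N : ℂ))
      = Complex.exp (-(2 * (Real.pi : ℂ) * n / N * k.val) * Complex.I) := by
    rw [Nat.cast_sub (by omega)]
    symm
    rw [← Complex.exp_periodic.nat_mul k.val]
    congr 1
    field_simp
    ring
  have e1 : Complex.exp (2 * (Real.pi : ℂ) * Complex.I * (n : ℂ) * (k.val : ℂ) / (N : ℂ))
      = Complex.exp ((2 * (Real.pi : ℂ) * n / N * k.val) * Complex.I) := by
    congr 1
    ring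
  rw [s1, s2, e1, e2, Complex.ofReal_sin, Complex.sin]
  push_cast
  ring
end

section
/- Let N be an even natural number with N ≥ 2, and let n be a natural number with 1 ≤ n < N/2. For the sequence x[k] = sin(ω_n k) (k = 0, …, N-1), the discrete Hilbert transform satisfies (H_d x)[k] = -cos(ω_n k) for all k. -/
theorem dht_aux_orth (N : ℕ) (hN : 2 ≤ N) (m : ℕ) (hm : m < N) (j : Fin N) :
    dft N (fun k => Complex.exp (2 * (Real.pi : ℂ) * Complex.I * (m : ℂ) * (k.val : ℂ) / (N : ℂ))) j
      = if j.val = m then 1 else 0 := by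
  have hN0 : (N : ℂ) ≠ 0 := by
    have : N ≠ 0 := by omega
    exact_mod_cast this
  have hp := Complex.isPrimitiveRoot_exp N (by omega)
  set z : ℂ := Complex.exp (2 * Real.pi * Complex.I / N) with hz
  have hz0 : z ≠ 0 := Complex.exp_ne_zero _
  have key : ∀ k : ℕ, Complex.exp (2 * (Real.pi : ℂ) * Complex.I * (m : ℂ) * (k : ℂ) / (N : ℂ)) *
      Complex.exp (-2 * (Real.pi : ℂ) * Complex.I * (j.val : ℂ) * (k : ℂ) / (N : ℂ))
      = (z ^ m / z ^ j.val) ^ k := by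
    intro k
    rw [hz, ← Complex.exp_nat_mul, ← Complex.exp_nat_mul, ← Complex.exp_sub, ← Complex.exp_nat_mul,
      ← Complex.exp_add]
    congr 1
    ring
  unfold dft
  simp only [key]
  rw [Fin.sum_univ_eq_sum_range (fun k => (z ^ m / z ^ j.val) ^ k) N]
  split_ifs with h
  · subst h
    rw [div_self (pow_ne_zero _ hz0)]
    simp [hN0]
  · have hne : z ^ m / z ^ j.val ≠ 1 := by
      intro h1
      rw [div_eq_one_iff_eq (pow_ne_zero _ hz0)] at h1
      exact h (hp.pow_inj hm j.isLt h1).symm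
    have h1 : (z ^ m / z ^ j.val) ^ N = 1 := by
      rw [div_pow, ← pow_mul, ← pow_mul, mul_comm m, mul_comm j.val, pow_mul, pow_mul,
        hp.pow_eq_one]
      simp
    rw [geom_sum_eq hne, h1]
    simp

theorem dht_aux_conj (N : ℕ) (hN : 2 ≤ N) (n : ℕ) (hn : n < N) (k : ℕ) :
    Complex.exp (2 * (Real.pi : ℂ) * Complex.I * ((N - n : ℕ) : ℂ) * (k : ℂ) / (N : ℂ))
      = Complex.exp (-(2 * (Real.pi : ℂ) * n / N * k) * Complex.I) := by
  have hN0 : (N : ℂ) ≠ 0 := by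
    have : N ≠ 0 := by omega
    exact_mod_cast this
  rw [Complex.exp_eq_exp_iff_exists_int]
  refine ⟨k, ?_⟩
  rw [Nat.cast_sub hn.le]
  push_cast
  field_simp
  ring

/-- For the sequence `x[k] = sin(ω_n k)` with `ω_n = 2πn/N`, `1 ≤ n < N/2`, the
discrete Hilbert transform satisfies `(H_d x)[k] = -cos(ω_n k)` for all `k`. -/
theorem dht_sin (N : ℕ) (hNeven : Even N) (hN : 2 ≤ N) (n : ℕ) (hn1 : 1 ≤ n)
    (hn2 : n < N / 2) (x : Fin N → ℂ)
    (hx : ∀ k : Fin N, x k = ((Real.sin (2 * Real.pi * n / N * k.val) : ℝ) : ℂ)) :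
    ∀ k : Fin N, dht N x k = -((Real.cos (2 * Real.pi * n / N * k.val) : ℝ) : ℂ) := by
  intro k
  have hdft : ∀ j : Fin N, dft N x j = (1 / (2 * Complex.I)) *
      ((if j.val = n then 1 else 0) - (if j.val = N - n then 1 else 0)) := by
    intro j
    rw [← dht_aux_orth N hN n (by omega) j, ← dht_aux_orth N hN (N - n) (by omega) j]
    unfold dft
    rw [← mul_sub, ← Finset.sum_sub_distrib, mul_left_comm]
    congr 1
    rw [Finset.mul_sum]
    refine Finset.sum_congr rfl fun l _ => ?_
    beta_reduce
    rw [← sub_mul, ← mul_assoc]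
    congr 1
    rw [hx, dht_aux_conj N hN n (by omega) l.val, Complex.ofReal_sin, Complex.sin]
    push_cast
    rw [show 2 * (Real.pi : ℂ) * Complex.I * n * l.val / N
      = 2 * (Real.pi : ℂ) * n / N * l.val * Complex.I by ring]
    field_simp
    rw [Complex.I_sq]
    ring
  have hs : ∀ (m : ℕ) (hm : m < N) (f : Fin N → ℂ),
      ∑ j : Fin N, f j * (if j.val = m then 1 else 0) = f ⟨m, hm⟩ := by
    intro m hm f
    rw [Finset.sum_eq_single ⟨m, hm⟩]
    · simp
    · intro b _ hb
      rw [if_neg (fun h => hb (Fin.ext h)), mul_zero]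
    · simp
  set g : Fin N → ℂ := fun j => (-Complex.I * dhtSign N j) * (1 / (2 * Complex.I)) *
    Complex.exp (2 * (Real.pi : ℂ) * Complex.I * (j.val : ℂ) * (k.val : ℂ) / (N : ℂ)) with hg
  have hd : dht N x k = g ⟨n, by omega⟩ - g ⟨N - n, by omega⟩ := by
    rw [← hs n (by omega) g, ← hs (N - n) (by omega) g, ← Finset.sum_sub_distrib]
    unfold dht
    refine Finset.sum_congr rfl fun j _ => ?_
    rw [hdft, hg]
    ring
  have s1 : dhtSign N ⟨n, by omega⟩ = 1 := by
    unfold dhtSign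
    rw [if_neg (by simp; omega), if_pos (by simp; omega)]
  have s2 : dhtSign N ⟨N - n, by omega⟩ = -1 := by
    unfold dhtSign
    rw [if_neg (by simp; omega), if_neg (by simp; omega)]
  rw [hd, hg]
  simp only [s1, s2]
  rw [dht_aux_conj N hN n (by omega) k.val, Complex.ofReal_cos, Complex.cos]
  push_cast
  rw [show 2 * (Real.pi : ℂ) * Complex.I * n * k.val / N
    = 2 * (Real.pi : ℂ) * n / N * k.val * Complex.I by ring]
  have hI := Complex.I_ne_zero
  field_simp
  ring
end

section
/- Let N be an even natural number with N ≥ 2, and let n be a natural number with 1 ≤ n < N/2. For the sequence x[k] = cos(ω_n k), the discrete analytic signal satisfies x[k] + i·(H_d x)[k] = exp(i ω_n k) for all k; consequently the reconstructed phase arg(x[k] + i·(H_d x)[k]) equals ω_n k modulo 2π, i.e., the Hilbert transform method perfectly reconstructs the phase of a discrete sinusoidal signal. -/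
theorem aux_orth (N : ℕ) (hN : N ≠ 0) (z : ℂ) (hz : IsPrimitiveRoot z N) (a b : ℕ)
    (ha : a < N) (hb : b < N) :
    ∑ k : Fin N, z ^ (a * k.val) * (z ^ (b * k.val))⁻¹ = if b = a then (N : ℂ) else 0 := by
  have hz0 : z ≠ 0 := hz.ne_zero hN
  rw [Fin.sum_univ_eq_sum_range (fun k => z ^ (a * k) * (z ^ (b * k))⁻¹) N]
  have h1 : ∀ k, z ^ (a * k) * (z ^ (b * k))⁻¹ = (z ^ a / z ^ b) ^ k := by
    intro k
    rw [pow_mul, pow_mul, div_pow, div_eq_mul_inv]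
  simp only [h1]
  split_ifs with h
  · subst h
    simp [hz0]
  · have hne : z ^ a / z ^ b ≠ 1 := by
      intro h2
      rw [div_eq_one_iff_eq (pow_ne_zero _ hz0)] at h2
      exact h (hz.pow_inj ha hb h2).symm
    rw [geom_sum_eq hne, div_pow, ← pow_mul, ← pow_mul, mul_comm a, mul_comm b, pow_mul,
      pow_mul, hz.pow_eq_one]
    simp

theorem aux_exp (N m k : ℕ) :
    Complex.exp (2 * (Real.pi : ℂ) * Complex.I * (m : ℂ) * (k : ℂ) / (N : ℂ)) =
      Complex.exp (2 * (Real.pi : ℂ) * Complex.I / (N : ℂ)) ^ (m * k) := by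
  rw [← Complex.exp_nat_mul]
  congr 1
  push_cast
  ring

theorem aux_exp_neg (N m k : ℕ) :
    Complex.exp (-2 * (Real.pi : ℂ) * Complex.I * (m : ℂ) * (k : ℂ) / (N : ℂ)) =
      (Complex.exp (2 * (Real.pi : ℂ) * Complex.I / (N : ℂ)) ^ (m * k))⁻¹ := by
  rw [← aux_exp, ← Complex.exp_neg]
  congr 1
  ring

/-- For `x[k] = cos(ω_n k)` with `ω_n = 2πn/N`, `1 ≤ n < N/2`, the discrete analytic
signal satisfies `x[k] + i (H_d x)[k] = exp(i ω_n k)`, and consequently the reconstructed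
phase `arg (x[k] + i (H_d x)[k])` equals `ω_n k` modulo `2π`. -/
theorem analytic_signal_cos (N : ℕ) (hNeven : Even N) (hN : 2 ≤ N) (n : ℕ) (hn1 : 1 ≤ n)
    (hn2 : n < N / 2) (x : Fin N → ℂ)
    (hx : ∀ k : Fin N, x k = ((Real.cos (2 * Real.pi * n / N * k.val) : ℝ) : ℂ)) :
    ∀ k : Fin N,
      x k + Complex.I * dht N x k =
        Complex.exp (Complex.I * ((2 * Real.pi * n / N : ℝ) : ℂ) * (k.val : ℂ)) ∧
      ∃ j : ℤ, (x k + Complex.I * dht N x k).arg =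
        2 * Real.pi * n / N * k.val + 2 * Real.pi * j := by
  have hN0 : N ≠ 0 := by omega
  have hz := Complex.isPrimitiveRoot_exp N hN0
  have hE := aux_exp N
  have hE' := aux_exp_neg N
  set z := Complex.exp (2 * (Real.pi : ℂ) * Complex.I / (N : ℂ)) with hzdef
  have hz0 : z ≠ 0 := hz.ne_zero hN0
  have hNC : (N : ℂ) ≠ 0 := by exact_mod_cast hN0
  have hinv : ∀ k : ℕ, z ^ ((N - n) * k) = (z ^ (n * k))⁻¹ := by
    intro k
    apply eq_inv_of_mul_eq_one_left
    rw [← pow_add, ← add_mul, Nat.sub_add_cancel (by omega), pow_mul, hz.pow_eq_one, one_pow]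
  have hx' : ∀ k : Fin N, x k = (z ^ (n * k.val) + z ^ ((N - n) * k.val)) / 2 := by
    intro k
    rw [hx, hinv, ← hE', ← hE, Complex.ofReal_cos, Complex.cos]
    push_cast
    congr 3 <;> ring
  have hd : ∀ m : Fin N, dft N x m =
      (if m.val = n then 1 / 2 else 0) + (if m.val = N - n then 1 / 2 else 0) := by
    intro m
    have e : ∀ k : Fin N, x k *
        Complex.exp (-2 * (Real.pi : ℂ) * Complex.I * (m.val : ℂ) * (k.val : ℂ) / (N : ℂ)) =
        (1 / 2) * (z ^ (n * k.val) * (z ^ (m.val * k.val))⁻¹) +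
        (1 / 2) * (z ^ ((N - n) * k.val) * (z ^ (m.val * k.val))⁻¹) := by
      intro k
      rw [hx', hE']
      ring
    rw [dft, Finset.sum_congr rfl (fun k _ => e k), Finset.sum_add_distrib, ← Finset.mul_sum,
      ← Finset.mul_sum, aux_orth N hN0 z hz n m (by omega) m.2,
      aux_orth N hN0 z hz (N - n) m (by omega) m.2]
    split_ifs <;> field_simp <;> simp
  have hH : ∀ k : Fin N, dht N x k =
      -Complex.I / 2 * z ^ (n * k.val) + Complex.I / 2 * z ^ ((N - n) * k.val) := by
    intro k
    have e : ∀ m : Fin N, (-Complex.I * dhtSign N m) * dft N x m *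
        Complex.exp (2 * (Real.pi : ℂ) * Complex.I * (m.val : ℂ) * (k.val : ℂ) / (N : ℂ)) =
        (if m = (⟨n, by omega⟩ : Fin N) then -Complex.I / 2 * z ^ (n * k.val) else 0) +
        (if m = (⟨N - n, by omega⟩ : Fin N) then
          Complex.I / 2 * z ^ ((N - n) * k.val) else 0) := by
      intro m
      rw [hd, hE, dhtSign]
      simp only [Fin.ext_iff]
      by_cases h1 : m.val = n
      · have h2 : ¬ n = N - n := by omega
        have h3 : n ≠ 0 := by omega
        have h4 : n ≤ N / 2 := by omega
        simp only [h1, h2, h3, h4, if_true, if_false]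
        ring
      · by_cases h2 : m.val = N - n
        · have h3 : ¬ N - n = 0 := by omega
          have h4 : ¬ N - n ≤ N / 2 := by omega
          have h5 : ¬ N - n = n := by omega
          simp only [h2, h3, h4, h5, if_true, if_false]
          ring
        · simp [h1, h2]
    rw [dht, Finset.sum_congr rfl (fun m _ => e m), Finset.sum_add_distrib,
      Finset.sum_ite_eq', Finset.sum_ite_eq']
    simp
  intro k
  have key : x k + Complex.I * dht N x k =
        Complex.exp (Complex.I * ((2 * Real.pi * n / N : ℝ) : ℂ) * (k.val : ℂ)) := by
    have e : Complex.exp (Complex.I * ((2 * Real.pi * n / N : ℝ) : ℂ) * (k.val : ℂ)) =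
        z ^ (n * k.val) := by
      rw [← hE]
      congr 1
      push_cast
      ring
    rw [e, hx', hH]
    linear_combination (-(1 / 2) * z ^ (n * k.val) + 1 / 2 * z ^ ((N - n) * k.val)) *
      Complex.I_mul_I
  refine ⟨key, ?_⟩
  rw [key]
  have e : Complex.I * ((2 * Real.pi * n / N : ℝ) : ℂ) * (k.val : ℂ) =
      ((2 * Real.pi * n / N * k.val : ℝ) : ℂ) * Complex.I := by
    push_cast
    ring
  rw [e, Complex.arg_exp_mul_I]
  refine ⟨-toIocDiv Real.two_pi_pos (-Real.pi) (2 * Real.pi * n / N * k.val), ?_⟩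
  rw [toIocMod, zsmul_eq_mul]
  push_cast
  ring
end

section
/- (Bedrosian's theorem for the discrete Hilbert transform.) Let N be an even natural number with N ≥ 2 and let x, y : Fin N → ℂ be sequences with discrete Fourier coefficients X_n and Y_n. Suppose there is a natural number m with 1 ≤ m such that X_n = 0 for all n with m ≤ n ≤ N - m, and Y_n = 0 for every n with 0 ≤ n ≤ N-1 that does not satisfy m ≤ n ≤ N/2 - m or N/2 + m ≤ n ≤ N - m (so the spectrum of x lies strictly below frequency index m, and the spectrum of y lies at least m away from the indices 0, N/2 and N). Then the discrete Hilbert transform of the pointwise product satisfies H_d(x·y)[k] = x[k] · (H_d y)[k] for all k. -/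
/-- The basic root of unity. -/
noncomputable def omg (N : ℕ) : ℂ := Complex.exp (2 * (Real.pi : ℂ) * Complex.I / (N : ℂ))

theorem exp_pos_eq (N n k : ℕ) :
    Complex.exp (2 * (Real.pi : ℂ) * Complex.I * (n : ℂ) * (k : ℂ) / (N : ℂ)) = omg N ^ (n * k) := by
  rw [omg, ← Complex.exp_nat_mul]
  congr 1
  push_cast
  ring

theorem exp_neg_eq (N n k : ℕ) :
    Complex.exp (-2 * (Real.pi : ℂ) * Complex.I * (n : ℂ) * (k : ℂ) / (N : ℂ))
      = (omg N ^ (n * k))⁻¹ := by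
  rw [← exp_pos_eq, ← Complex.exp_neg]
  congr 1
  ring

theorem omg_orth (N : ℕ) (hN : 2 ≤ N) (r n : Fin N) :
    ∑ k : Fin N, omg N ^ (r.val * k.val) * (omg N ^ (n.val * k.val))⁻¹
      = if n = r then (N : ℂ) else 0 := by
  have hp : IsPrimitiveRoot (omg N) N := Complex.isPrimitiveRoot_exp N (by omega)
  have h0 : omg N ≠ 0 := hp.ne_zero (by omega)
  split_ifs with h
  · subst h
    simp [h0]
  · have hz : omg N ^ r.val * (omg N ^ n.val)⁻¹ ≠ 1 := by
      intro hc
      have : omg N ^ r.val = omg N ^ n.val := by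
        field_simp at hc
        exact hc
      exact h (Fin.ext (hp.pow_inj r.2 n.2 this).symm)
    have hzN : (omg N ^ r.val * (omg N ^ n.val)⁻¹) ^ N = 1 := by
      rw [mul_pow, inv_pow, ← pow_mul, ← pow_mul, mul_comm r.val, mul_comm n.val, pow_mul, pow_mul,
        hp.pow_eq_one]
      simp
    have := Fin.sum_univ_eq_sum_range (fun k => (omg N ^ r.val * (omg N ^ n.val)⁻¹) ^ k) N
    rw [geom_sum_eq hz, hzN, sub_self, zero_div] at this
    rw [← this]
    refine Finset.sum_congr rfl fun k _ => ?_
    rw [mul_pow, inv_pow, ← pow_mul, ← pow_mul]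

theorem dft_inv (N : ℕ) (hN : 2 ≤ N) (x : Fin N → ℂ) (k : Fin N) :
    x k = ∑ p : Fin N, dft N x p * omg N ^ (p.val * k.val) := by
  have hN0 : (N : ℂ) ≠ 0 := by
    have : N ≠ 0 := by omega
    exact_mod_cast this
  have h : ∑ p : Fin N, dft N x p * omg N ^ (p.val * k.val)
      = ∑ j : Fin N, (1 / (N : ℂ)) * x j *
        ∑ p : Fin N, omg N ^ (k.val * p.val) * (omg N ^ (j.val * p.val))⁻¹ := by
    simp only [dft, exp_neg_eq, Finset.mul_sum, Finset.sum_mul]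
    rw [Finset.sum_comm]
    refine Finset.sum_congr rfl fun j _ => Finset.sum_congr rfl fun p _ => ?_
    rw [mul_comm k.val, mul_comm j.val]
    ring
  rw [h]
  simp only [omg_orth N hN]
  simp
  field_simp

theorem dht_char (N : ℕ) (hN : 2 ≤ N) (r k : Fin N) :
    dht N (fun j => omg N ^ (r.val * j.val)) k
      = -Complex.I * dhtSign N r * omg N ^ (r.val * k.val) := by
  have hN0 : (N : ℂ) ≠ 0 := by
    have : N ≠ 0 := by omega
    exact_mod_cast this
  simp only [dht, dft, exp_neg_eq, exp_pos_eq, omg_orth N hN]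
  rw [Finset.sum_eq_single r]
  · simp [hN0]
  · intro b _ hb
    simp [hb]
  · simp

theorem dht_sum (N : ℕ) {ι : Type} (s : Finset ι) (c : ι → ℂ) (f : ι → Fin N → ℂ) (k : Fin N) :
    dht N (fun j => ∑ i ∈ s, c i * f i j) k = ∑ i ∈ s, c i * dht N (f i) k := by
  simp only [dht, dft, Finset.mul_sum, Finset.sum_mul]
  rw [Finset.sum_comm (s := s)]
  refine Finset.sum_congr rfl fun n _ => ?_
  rw [Finset.sum_comm]
  refine Finset.sum_congr rfl fun i _ => Finset.sum_congr rfl fun j _ => ?_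
  ring

theorem omg_mod (N : ℕ) (hN : 2 ≤ N) (a k : ℕ) : omg N ^ (a % N * k) = omg N ^ (a * k) := by
  have hp : IsPrimitiveRoot (omg N) N := Complex.isPrimitiveRoot_exp N (by omega)
  rw [pow_mul, pow_mul, ← pow_eq_pow_mod a hp.pow_eq_one]

/-- Bedrosian's theorem for the discrete Hilbert transform: if the spectrum of `x` lies
strictly below frequency index `m`, and the spectrum of `y` lies at least `m` away from
the indices `0`, `N/2` and `N`, then `H_d (x·y)[k] = x[k] · (H_d y)[k]` for all `k`. -/
theorem dht_bedrosian (N : ℕ) (hNeven : Even N) (hN : 2 ≤ N) (x y : Fin N → ℂ)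
    (m : ℕ) (hm : 1 ≤ m)
    (hx : ∀ n : Fin N, m ≤ n.val → n.val ≤ N - m → dft N x n = 0)
    (hy : ∀ n : Fin N,
      ¬((m ≤ n.val ∧ n.val ≤ N / 2 - m) ∨ (N / 2 + m ≤ n.val ∧ n.val ≤ N - m)) →
      dft N y n = 0) :
    ∀ k : Fin N, dht N (fun k' => x k' * y k') k = x k * dht N y k := by
  intro k
  have hxy : (fun k' => x k' * y k') = fun j : Fin N => ∑ i : Fin N × Fin N,
      (dft N x i.1 * dft N y i.2) * omg N ^ ((i.1.val + i.2.val) % N * j.val) := by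
    funext j
    rw [dft_inv N hN x j, dft_inv N hN y j, Finset.sum_mul_sum, Fintype.sum_prod_type]
    refine Finset.sum_congr rfl fun p _ => Finset.sum_congr rfl fun q _ => ?_
    rw [omg_mod N hN, add_mul, pow_add]
    ring
  rw [hxy, dht_sum N Finset.univ (fun i : Fin N × Fin N => dft N x i.1 * dft N y i.2)
    (fun i j => omg N ^ ((i.1.val + i.2.val) % N * j.val)) k]
  rw [dft_inv N hN x k]
  simp only [dht.eq_def N y k, exp_pos_eq]
  rw [Finset.sum_mul_sum, Fintype.sum_prod_type]
  refine Finset.sum_congr rfl fun p _ => Finset.sum_congr rfl fun q _ => ?_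
  have hc := dht_char N hN ⟨(p.val + q.val) % N, Nat.mod_lt _ (by omega)⟩ k
  simp only at hc
  rw [hc, omg_mod N hN, add_mul, pow_add]
  by_cases hxp : m ≤ p.val ∧ p.val ≤ N - m
  · rw [hx p hxp.1 hxp.2]
    ring
  by_cases hyq : (m ≤ q.val ∧ q.val ≤ N / 2 - m) ∨ (N / 2 + m ≤ q.val ∧ q.val ≤ N - m)
  swap
  · rw [hy q hyq]
    ring
  have hs : dhtSign N ⟨(p.val + q.val) % N, Nat.mod_lt _ (by omega)⟩ = dhtSign N q := by
    obtain ⟨M, hM⟩ := hNeven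
    have hp := p.2
    have hq := q.2
    have hmod : (p.val + q.val) % N = if p.val + q.val < N then p.val + q.val
        else p.val + q.val - N := by
      split_ifs with h
      · exact Nat.mod_eq_of_lt h
      · rw [Nat.mod_eq_sub_mod (by omega), Nat.mod_eq_of_lt (by omega)]
    simp only [dhtSign, hmod]
    split_ifs <;> first | rfl | (exfalso; omega)
  rw [hs]
  ring
end

section
/- (Low-frequency modulation case.) Let N be an even natural number and m a natural number with 4m < N; write ω_n = 2πn/N. Let n be a natural number with 0 ≤ n ≤ m-1 and let c ∈ ℂ, and let v[k] = c·exp(i k ω_n) + conj(c)·exp(-i k ω_n). Then H_d(k ↦ v[k]·sin(ω_m k))[k] = -v[k]·cos(ω_m k) for all k. -/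
/-- The discrete exponential of integer frequency `p`. -/
noncomputable def dexpo (N : ℕ) (p : ℤ) (k : Fin N) : ℂ :=
  Complex.exp (2 * (Real.pi : ℂ) * Complex.I * (p : ℂ) * (k.val : ℂ) / (N : ℂ))

lemma dexpo_sum_zero (N : ℕ) (hN : N ≠ 0) (d : ℤ) (hd : ¬ (N : ℤ) ∣ d) :
    ∑ k : Fin N, dexpo N d k = 0 := by
  have hN' : (N : ℂ) ≠ 0 := by exact_mod_cast hN
  set z : ℂ := Complex.exp (2 * (Real.pi : ℂ) * Complex.I * (d : ℂ) / (N : ℂ)) with hz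
  have h1 : ∀ k : Fin N, dexpo N d k = z ^ (k.val) := by
    intro k
    rw [hz, ← Complex.exp_nat_mul, dexpo]
    congr 1
    ring
  have hzN : z ^ N = 1 := by
    rw [hz, ← Complex.exp_nat_mul, Complex.exp_eq_one_iff]
    refine ⟨d, ?_⟩
    field_simp
  have hz1 : z ≠ 1 := by
    intro h
    rw [hz, Complex.exp_eq_one_iff] at h
    obtain ⟨j, hj⟩ := h
    apply hd
    refine ⟨j, ?_⟩
    have hpi : (2 * (Real.pi : ℂ) * Complex.I) ≠ 0 := Complex.two_pi_I_ne_zero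
    rw [div_eq_iff hN'] at hj
    have : (d : ℂ) = N * j := by
      apply mul_left_cancel₀ hpi
      rw [hj]; ring
    exact_mod_cast this
  rw [Finset.sum_congr rfl (fun k _ => h1 k), Fin.sum_univ_eq_sum_range (fun i => z ^ i) N]
  have := mul_geom_sum z N
  rw [hzN, sub_self] at this
  exact (mul_eq_zero.mp this).resolve_left (sub_ne_zero.mpr hz1)

lemma dft_dexpo (N : ℕ) (p q : Fin N) :
    dft N (dexpo N (p.val : ℤ)) q = if q = p then 1 else 0 := by
  have hN : N ≠ 0 := by have := p.isLt; omega
  have hN' : (N : ℂ) ≠ 0 := by exact_mod_cast hN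
  have h : dft N (dexpo N (p.val : ℤ)) q =
      (1 / (N : ℂ)) * ∑ k : Fin N, dexpo N ((p.val : ℤ) - q.val) k := by
    unfold dft dexpo
    congr 1
    refine Finset.sum_congr rfl fun k _ => ?_
    rw [← Complex.exp_add]
    congr 1
    push_cast
    ring
  rw [h]
  split_ifs with hqp
  · subst hqp
    simp [dexpo, hN']
  · rw [dexpo_sum_zero N hN, mul_zero]
    intro hd
    apply hqp
    have h1 := p.isLt
    have h2 := q.isLt
    have := Int.eq_zero_of_abs_lt_dvd hd (by rw [abs_lt]; omega)
    exact Fin.ext (by omega)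

lemma dht_dexpo (N : ℕ) (p k : Fin N) :
    dht N (dexpo N (p.val : ℤ)) k = -Complex.I * dhtSign N p * dexpo N (p.val : ℤ) k := by
  unfold dht
  rw [Finset.sum_eq_single p]
  · rw [dft_dexpo]; simp [dexpo]
  · intro b _ hb
    rw [dft_dexpo]; simp [hb]
  · simp

lemma dht_pos (N : ℕ) (p : ℕ) (h0 : 0 < p) (h1 : 2 * p < N) (k : Fin N) :
    dht N (dexpo N (p : ℤ)) k = -Complex.I * dexpo N (p : ℤ) k := by
  have := dht_dexpo N ⟨p, by omega⟩ k
  simp only [dhtSign] at this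
  rw [if_neg (by omega), if_pos (by omega)] at this
  simpa using this

lemma dexpo_neg_eq (N : ℕ) (p : ℕ) (h1 : p < N) :
    dexpo N (-(p : ℤ)) = dexpo N (((N - p : ℕ)) : ℤ) := by
  have hN' : (N : ℂ) ≠ 0 := by exact_mod_cast (by omega : N ≠ 0)
  funext k
  unfold dexpo
  rw [Complex.exp_eq_exp_iff_exists_int]
  refine ⟨-(k.val : ℤ), ?_⟩
  rw [Nat.cast_sub h1.le]
  push_cast
  field_simp
  ring

lemma dht_neg (N : ℕ) (p : ℕ) (h0 : 0 < p) (h1 : 2 * p < N) (k : Fin N) :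
    dht N (dexpo N (-(p : ℤ))) k = Complex.I * dexpo N (-(p : ℤ)) k := by
  rw [dexpo_neg_eq N p (by omega)]
  have := dht_dexpo N ⟨N - p, by omega⟩ k
  simp only [dhtSign] at this
  by_cases hh : N - p ≤ N / 2
  · omega
  rw [if_neg (by omega), if_neg hh] at this
  simpa using this

lemma dht_comb (N : ℕ) (x y : Fin N → ℂ) (a : ℂ) (k : Fin N) :
    dht N (fun j => x j + a * y j) k = dht N x k + a * dht N y k := by
  have h : ∀ q, dft N (fun j => x j + a * y j) q = dft N x q + a * dft N y q := by
    intro q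
    simp only [dft, add_mul, Finset.sum_add_distrib, mul_add, Finset.mul_sum]
    congr 1
    refine Finset.sum_congr rfl fun k _ => ?_
    ring
  simp only [dht, h, Finset.mul_sum]
  rw [← Finset.sum_add_distrib]
  refine Finset.sum_congr rfl fun k _ => ?_
  ring

lemma dht_zero (N : ℕ) (k : Fin N) : dht N (fun _ => 0) k = 0 := by
  simp [dht, dft]

lemma dexpo_mul (N : ℕ) (p q : ℤ) (k : Fin N) :
    dexpo N p k * dexpo N q k = dexpo N (p + q) k := by
  unfold dexpo
  rw [← Complex.exp_add]
  congr 1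
  push_cast
  ring

/-- Low-frequency modulation case: for `v[k] = c exp(i k ω_n) + conj c exp(-i k ω_n)`
with `0 ≤ n ≤ m - 1`, one has `H_d (k ↦ v[k] sin(ω_m k))[k] = -v[k] cos(ω_m k)`. -/
theorem dht_low_freq (N m : ℕ) (hNeven : Even N) (h4m : 4 * m < N)
    (n : ℕ) (hn : n < m) (c : ℂ) (v : Fin N → ℂ)
    (hv : ∀ k : Fin N, v k =
      c * Complex.exp (Complex.I * (k.val : ℂ) * ((2 * Real.pi * n / N : ℝ) : ℂ)) +
      (starRingEnd ℂ) c *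
        Complex.exp (-Complex.I * (k.val : ℂ) * ((2 * Real.pi * n / N : ℝ) : ℂ))) :
    ∀ k : Fin N,
      dht N (fun k' => v k' * ((Real.sin (2 * Real.pi * m / N * k'.val) : ℝ) : ℂ)) k =
        -v k * ((Real.cos (2 * Real.pi * m / N * k.val) : ℝ) : ℂ) := by

  have hv' : ∀ j, v j = c * dexpo N n j + (starRingEnd ℂ) c * dexpo N (-(n : ℤ)) j := by
    intro j
    rw [hv j, dexpo, dexpo]
    congr 3 <;> push_cast <;> ring
  have e1 : ∀ j : Fin N, Complex.exp (((2 * Real.pi * m / N * j.val : ℝ) : ℂ) * Complex.I)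
      = dexpo N m j := by
    intro j
    rw [dexpo]
    congr 1
    push_cast
    ring
  have e2 : ∀ j : Fin N, Complex.exp (-((2 * Real.pi * m / N * j.val : ℝ) : ℂ) * Complex.I)
      = dexpo N (-(m : ℤ)) j := by
    intro j
    rw [dexpo]
    congr 1
    push_cast
    ring
  have hmul : ∀ j : Fin N,
      dexpo N n j * dexpo N m j = dexpo N ((m + n : ℕ) : ℤ) j ∧
      dexpo N n j * dexpo N (-(m : ℤ)) j = dexpo N (-((m - n : ℕ) : ℤ)) j ∧
      dexpo N (-(n : ℤ)) j * dexpo N m j = dexpo N ((m - n : ℕ) : ℤ) j ∧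
      dexpo N (-(n : ℤ)) j * dexpo N (-(m : ℤ)) j = dexpo N (-((m + n : ℕ) : ℤ)) j := by
    intro j
    refine ⟨?_, ?_, ?_, ?_⟩ <;> rw [dexpo_mul] <;> congr 1 <;> omega
  have hs : (fun k' : Fin N => v k' * ((Real.sin (2 * Real.pi * m / N * k'.val) : ℝ) : ℂ)) =
      fun j => (((0 + (-Complex.I / 2 * c) * dexpo N ((m + n : ℕ) : ℤ) j)
        + (Complex.I / 2 * c) * dexpo N (-((m - n : ℕ) : ℤ)) j)
        + (-Complex.I / 2 * (starRingEnd ℂ) c) * dexpo N ((m - n : ℕ) : ℤ) j)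
        + (Complex.I / 2 * (starRingEnd ℂ) c) * dexpo N (-((m + n : ℕ) : ℤ)) j := by
    funext j
    obtain ⟨h1, h2, h3, h4⟩ := hmul j
    rw [hv' j, Complex.ofReal_sin, Complex.sin, e1, e2, ← h1, ← h2, ← h3, ← h4]
    ring
  intro k
  rw [hs, dht_comb, dht_comb, dht_comb, dht_comb, dht_zero,
    dht_pos N (m + n) (by omega) (by omega), dht_pos N (m - n) (by omega) (by omega),
    dht_neg N (m + n) (by omega) (by omega), dht_neg N (m - n) (by omega) (by omega)]
  obtain ⟨h1, h2, h3, h4⟩ := hmul k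
  rw [hv' k, Complex.ofReal_cos, Complex.cos, e1, e2, ← h1, ← h2, ← h3, ← h4]
  ring_nf
  simp only [Complex.I_sq]
  ring
end

section
/- (Middle-frequency modulation case.) Let N be an even natural number and m a natural number with 1 ≤ m and 4m < N; write ω_m = 2πm/N. Let c ∈ ℂ and let v[k] = c·exp(i k ω_m) + conj(c)·exp(-i k ω_m). Then H_d(k ↦ v[k]·sin(ω_m k))[k] = -(1/2)·( c·exp(2 i k ω_m) + conj(c)·exp(-2 i k ω_m) ) for all k. -/
/-- The discrete exponential `k ↦ exp(2πi p k / N)`. -/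
noncomputable def dexp (N p : ℕ) (k : Fin N) : ℂ :=
  Complex.exp (2 * (Real.pi : ℂ) * Complex.I * (p : ℂ) * (k.val : ℂ) / (N : ℂ))

theorem dft_dexp (N p : ℕ) (hp : p < N) (n : Fin N) :
    dft N (dexp N p) n = if n = ⟨p, hp⟩ then 1 else 0 := by
  have hN : (N : ℂ) ≠ 0 := by
    have : N ≠ 0 := by omega
    exact_mod_cast this
  have hζ := Complex.isPrimitiveRoot_exp N (by omega)
  set ζ := Complex.exp (2 * Real.pi * Complex.I / N) with hζd
  have hζ0 : ζ ≠ 0 := Complex.exp_ne_zero _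
  have key : ∀ k : Fin N, dexp N p k *
      Complex.exp (-2 * (Real.pi : ℂ) * Complex.I * (n.val : ℂ) * (k.val : ℂ) / (N : ℂ))
      = (ζ ^ p * (ζ ^ n.val)⁻¹) ^ k.val := by
    intro k
    rw [dexp, hζd, ← Complex.exp_nat_mul, ← Complex.exp_nat_mul, ← Complex.exp_neg,
      ← Complex.exp_add, ← Complex.exp_add, ← Complex.exp_nat_mul]
    congr 1
    ring
  unfold dft
  rw [Finset.sum_congr rfl (fun k _ => key k),
    Fin.sum_univ_eq_sum_range (fun k => (ζ ^ p * (ζ ^ n.val)⁻¹) ^ k) N]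
  split_ifs with h
  · subst h
    simp [hζ0, hN]
  · have hr : ζ ^ p * (ζ ^ n.val)⁻¹ ≠ 1 := by
      intro h1
      apply h
      have h2 : ζ ^ p = ζ ^ n.val := by
        rwa [← div_eq_mul_inv, div_eq_one_iff_eq (pow_ne_zero _ hζ0)] at h1
      exact Fin.ext (hζ.pow_inj hp n.isLt h2).symm
    rw [geom_sum_eq hr]
    have : (ζ ^ p * (ζ ^ n.val)⁻¹) ^ N = 1 := by
      rw [mul_pow, inv_pow, ← pow_mul, ← pow_mul, mul_comm p, mul_comm n.val, pow_mul, pow_mul,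
        hζ.pow_eq_one]
      simp
    rw [this]
    simp

theorem dht_dexp (N p : ℕ) (hp : p < N) (k : Fin N) :
    dht N (dexp N p) k = -Complex.I * dhtSign N ⟨p, hp⟩ * dexp N p k := by
  unfold dht
  simp only [dft_dexp N p hp]
  rw [Finset.sum_eq_single ⟨p, hp⟩]
  · simp [dexp]
  · intro b _ hb
    simp [hb]
  · simp

theorem dht_add (N : ℕ) (x y : Fin N → ℂ) (k : Fin N) :
    dht N (fun j => x j + y j) k = dht N x k + dht N y k := by
  simp only [dht, dft, add_mul, Finset.sum_add_distrib, mul_add]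

theorem dht_smul (N : ℕ) (a : ℂ) (x : Fin N → ℂ) (k : Fin N) :
    dht N (fun j => a * x j) k = a * dht N x k := by
  have h : ∀ n, dft N (fun j => a * x j) n = a * dft N x n := by
    intro n
    simp only [dft, mul_assoc a, ← Finset.mul_sum]
    ring
  unfold dht
  rw [Finset.mul_sum]
  refine Finset.sum_congr rfl fun n _ => ?_
  rw [h]
  ring

/-- Middle-frequency modulation case: for `v[k] = c exp(i k ω_m) + conj c exp(-i k ω_m)`,
one has `H_d (k ↦ v[k] sin(ω_m k))[k] = -(1/2)(c exp(2 i k ω_m) + conj c exp(-2 i k ω_m))`. -/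
theorem dht_mid_freq (N m : ℕ) (hNeven : Even N) (hm : 1 ≤ m) (h4m : 4 * m < N)
    (c : ℂ) (v : Fin N → ℂ)
    (hv : ∀ k : Fin N, v k =
      c * Complex.exp (Complex.I * (k.val : ℂ) * ((2 * Real.pi * m / N : ℝ) : ℂ)) +
      (starRingEnd ℂ) c *
        Complex.exp (-Complex.I * (k.val : ℂ) * ((2 * Real.pi * m / N : ℝ) : ℂ))) :
    ∀ k : Fin N,
      dht N (fun k' => v k' * ((Real.sin (2 * Real.pi * m / N * k'.val) : ℝ) : ℂ)) k =
        -(1 / 2) *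
          (c * Complex.exp (2 * Complex.I * (k.val : ℂ) * ((2 * Real.pi * m / N : ℝ) : ℂ)) +
           (starRingEnd ℂ) c *
             Complex.exp (-2 * Complex.I * (k.val : ℂ) * ((2 * Real.pi * m / N : ℝ) : ℂ))) := by
  intro k
  have hN : (N : ℂ) ≠ 0 := by
    have : N ≠ 0 := by omega
    exact_mod_cast this
  have hpos : ∀ j : Fin N, dexp N (2 * m) j =
      Complex.exp (2 * Complex.I * (j.val : ℂ) * ((2 * Real.pi * m / N : ℝ) : ℂ)) := by
    intro j
    rw [dexp]
    congr 1
    push_cast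
    ring
  have hneg : ∀ j : Fin N, dexp N (N - 2 * m) j =
      Complex.exp (-2 * Complex.I * (j.val : ℂ) * ((2 * Real.pi * m / N : ℝ) : ℂ)) := by
    intro j
    rw [dexp, Complex.exp_eq_exp_iff_exists_int]
    refine ⟨j.val, ?_⟩
    rw [Nat.cast_sub (by omega)]
    push_cast
    field_simp
    ring
  have hzero : ∀ j : Fin N, dexp N 0 j = 1 := by
    intro j
    simp [dexp]
  have hx : (fun k' : Fin N => v k' * ((Real.sin (2 * Real.pi * m / N * k'.val) : ℝ) : ℂ)) =
      fun j => (-Complex.I / 2 * c) * dexp N (2 * m) j +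
        ((Complex.I / 2 * (starRingEnd ℂ) c) * dexp N (N - 2 * m) j +
        (Complex.I / 2 * (c - (starRingEnd ℂ) c)) * dexp N 0 j) := by
    funext j
    rw [hpos, hneg, hzero, hv, Complex.ofReal_sin, Complex.sin]
    set θ : ℂ := Complex.I * (j.val : ℂ) * ((2 * Real.pi * m / N : ℝ) : ℂ) with hθ
    have e1 : -Complex.I * (j.val : ℂ) * ((2 * Real.pi * m / N : ℝ) : ℂ) = -θ := by
      rw [hθ]; ring
    have e2 : 2 * Complex.I * (j.val : ℂ) * ((2 * Real.pi * m / N : ℝ) : ℂ) = θ + θ := by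
      rw [hθ]; ring
    have e3 : -2 * Complex.I * (j.val : ℂ) * ((2 * Real.pi * m / N : ℝ) : ℂ) = -θ + -θ := by
      rw [hθ]; ring
    have e4 : ((2 * Real.pi * m / N * j.val : ℝ) : ℂ) * Complex.I = θ := by
      rw [hθ]; push_cast; ring
    have e5 : -((2 * Real.pi * m / N * j.val : ℝ) : ℂ) * Complex.I = -θ := by
      rw [neg_mul, e4]
    rw [e1, e2, e3, e4, e5, Complex.exp_add, Complex.exp_add]
    have h1 : Complex.exp θ * Complex.exp (-θ) = 1 := by
      rw [← Complex.exp_add]; simp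
    linear_combination (Complex.I / 2 * (c - (starRingEnd ℂ) c)) * h1
  rw [hx, dht_add, dht_add, dht_smul, dht_smul, dht_smul, dht_dexp N (2 * m) (by omega),
    dht_dexp N (N - 2 * m) (by omega), dht_dexp N 0 (by omega), ← hpos, ← hneg]
  have s1 : dhtSign N ⟨2 * m, by omega⟩ = 1 := by
    unfold dhtSign
    rw [if_neg (by simp only; omega), if_pos (by simp only; omega)]
  have s2 : dhtSign N ⟨N - 2 * m, by omega⟩ = -1 := by
    unfold dhtSign
    rw [if_neg (by simp only; omega), if_neg (by simp only; omega)]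
  have s3 : dhtSign N ⟨0, by omega⟩ = 0 := by
    simp [dhtSign]
  rw [s1, s2, s3]
  linear_combination (c / 2 * dexp N (2 * m) k +
    (starRingEnd ℂ) c / 2 * dexp N (N - 2 * m) k) * Complex.I_mul_I
end
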